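/- Assume T > R > P > S, 2R > T + S, 0 ≤ γ < 1 and γ² > (T−R)/(R−P). Let τ be the retarded Win-Stay Lose-Shift (retarded WSLS) strategy: τ(s1,s2) = C if s2 ∈ {(C,C),(D,D)} and τ(s1,s2) = D otherwise (note τ(π(s1),π(s2)) = τ(s1,s2), so the mirrored strategy coincides with τ). Then there exists Q : {C,D} × Ω × Ω → ℝ satisfying the player-1 memory-two Bellman optimality equation against τ such that for all states s1, s2: if s2 ∈ {(C,C),(D,D)} then Q(C,s1,s2) > Q(D,s1,s2), and if s2 ∈ {(C,D),(D,C)} then Q(D,s1,s2) > Q(C,s1,s2); that is, a pair of retarded WSLS strategies forms a symmetric mutual reinforcement learning equilibrium. -/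

import Mathlib

inductive Act where
  | C : Act
  | D : Act
deriving DecidableEq

open Act

abbrev St : Type := Act × Act

/-- Player 1's payoff in the prisoner's dilemma. -/
def r1 (R S T P : ℝ) : Act → Act → ℝ
  | C, C => R
  | C, D => S
  | D, C => T
  | D, D => P

/-- Swap the roles of the two players in a state. -/
def pi' (s : St) : St := (s.2, s.1)

/-- the retarded WSLS strategy forms a symmetric mutual reinforcement learning
equilibrium when `γ² > (T−R)/(R−P)`. -/
theorem stmt_9 (R S T P γ : ℝ) (hTR : T > R) (hRP : R > P) (hPS : P > S)
    (h2R : 2 * R > T + S) (hγ0 : 0 ≤ γ) (hγ1 : γ < 1)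
    (hγ2 : γ ^ 2 > (T - R) / (R - P))
    (τ : St → St → Act)
    (hτ : ∀ s1 s2, τ s1 s2 = if s2 = (C, C) ∨ s2 = (D, D) then C else D) :
    ∃ Q : Act → St → St → ℝ,
      (∀ σ s1 s2, Q σ s1 s2 =
        r1 R S T P σ (τ s1 s2) +
          γ * max (Q C (σ, τ s1 s2) s1) (Q D (σ, τ s1 s2) s1)) ∧
      (∀ s1 s2 : St, (s2 = (C, C) ∨ s2 = (D, D) → Q C s1 s2 > Q D s1 s2) ∧
        (s2 = (C, D) ∨ s2 = (D, C) → Q D s1 s2 > Q C s1 s2)) := by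
  have hRP' : 0 < R - P := by linarith
  have key : T - R < γ ^ 2 * (R - P) := (div_lt_iff₀ hRP').mp hγ2
  obtain ⟨v, hv⟩ : ∃ v : ℝ, v = R + γ * v := by
    have h : 1 - γ ≠ 0 := by linarith
    refine ⟨R / (1 - γ), ?_⟩
    field_simp
    ring
  -- `u s` is the payoff, two rounds after `s`, of a player who follows retarded WSLS.
  let u : St → ℝ := fun s => if s = (C, C) ∨ s = (D, D) then R else P
  -- `W s1 s2` is the resulting discounted total payoff from the history `s1, s2`.
  let W : St → St → ℝ := fun s1 s2 => u s2 + γ * (u s1 + γ * v)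
  let Q : Act → St → St → ℝ := fun σ s1 s2 =>
    r1 R S T P σ (τ s1 s2) + γ * W (σ, τ s1 s2) s1
  have hgt : ∀ s1 s2 : St, (s2 = (C, C) ∨ s2 = (D, D) → Q C s1 s2 > Q D s1 s2) ∧
      (s2 = (C, D) ∨ s2 = (D, C) → Q D s1 s2 > Q C s1 s2) := by
    rintro s1 ⟨_ | _, _ | _⟩ <;> simp [Q, W, u, hτ, r1] <;> nlinarith
  have hmax : ∀ s1 s2 : St, max (Q C s1 s2) (Q D s1 s2) = W s1 s2 := by
    intro s1 s2
    obtain ⟨hC, hD⟩ := hgt s1 s2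
    rcases s2 with ⟨_ | _, _ | _⟩
    · rw [max_eq_left (hC (by simp)).le]
      simp [Q, W, u, hτ, r1, ← hv]
    · rw [max_eq_right (hD (by simp)).le]
      simp [Q, W, u, hτ, r1, ← hv]
    · rw [max_eq_right (hD (by simp)).le]
      simp [Q, W, u, hτ, r1, ← hv]
    · rw [max_eq_left (hC (by simp)).le]
      simp [Q, W, u, hτ, r1, ← hv]
  exact ⟨Q, fun σ s1 s2 => by rw [hmax], hgt⟩
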